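/- Let p be a real number with 1 < p < ∞ and let A be a bounded subset of ℓ^p containing at least two points which is extremal (i.e. r(A) = 2^(−1/q) · d(A) if 1 < p ≤ 2 with q = p/(p−1), and r(A) = 2^(−1/p) · d(A) if p > 2). Then A is not relatively compact in ℓ^p. -/

import Mathlib

open scoped ENNReal

noncomputable def chebRadius {p : ℝ≥0∞} [Fact (1 ≤ p)]
    (A : Set (lp (fun _ : ℕ => ℝ) p)) : ℝ :=
  ⨅ y : lp (fun _ : ℕ => ℝ) p, ⨆ x : A, ‖(x : lp (fun _ : ℕ => ℝ) p) - y‖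

/-- The odd power function `s ↦ sign s * |s| ^ θ`, written as a difference of two powers. -/
noncomputable def signedRpow (θ s : ℝ) : ℝ := max s 0 ^ θ - max (-s) 0 ^ θ

namespace signedRpow

variable {θ : ℝ}

lemma of_nonneg (hθ : 0 < θ) {s : ℝ} (hs : 0 ≤ s) : signedRpow θ s = s ^ θ := by
  simp [signedRpow, hs, Real.zero_rpow hθ.ne']

lemma neg (s : ℝ) : signedRpow θ (-s) = -signedRpow θ s := by
  simp [signedRpow]

lemma of_nonpos (hθ : 0 < θ) {s : ℝ} (hs : s ≤ 0) : signedRpow θ s = -(-s) ^ θ := by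
  rw [← of_nonneg hθ (neg_nonneg.2 hs), neg, neg_neg]

lemma continuous (hθ : 0 < θ) : Continuous (signedRpow θ) :=
  ((continuous_id.max continuous_const).rpow_const fun _ => Or.inr hθ.le).sub
    ((continuous_neg.max continuous_const).rpow_const fun _ => Or.inr hθ.le)

lemma abs_eq (hθ : 0 < θ) (s : ℝ) : |signedRpow θ s| = |s| ^ θ := by
  rcases le_total 0 s with hs | hs
  · rw [of_nonneg hθ hs, abs_of_nonneg hs, abs_of_nonneg (by positivity)]
  · have := neg_nonneg.2 hs
    rw [of_nonpos hθ hs, abs_neg, abs_of_nonpos hs, abs_of_nonneg (by positivity)]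

lemma mul_self (hθ : 0 < θ) (s : ℝ) : signedRpow θ s * s = |s| ^ (θ + 1) := by
  rw [Real.rpow_add_one' (abs_nonneg s) (by positivity)]
  rcases le_total 0 s with hs | hs
  · rw [of_nonneg hθ hs, abs_of_nonneg hs]
  · rw [of_nonpos hθ hs, abs_of_nonpos hs]
    ring

lemma sub_le (hθ : 0 < θ) (hθ1 : θ ≤ 1) {a b : ℝ} (hab : b ≤ a) :
    signedRpow θ a - signedRpow θ b ≤ 2 ^ (1 - θ) * (a - b) ^ θ := by
  have h2 : (1 : ℝ) ≤ 2 ^ (1 - θ) := Real.one_le_rpow one_le_two (by linarith)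
  have hd : 0 ≤ (a - b) ^ θ := Real.rpow_nonneg (by linarith) _
  have hd' : (a - b) ^ θ ≤ 2 ^ (1 - θ) * (a - b) ^ θ := le_mul_of_one_le_left hd h2
  rcases le_total 0 b with hb | hb
  · have := Real.rpow_add_le_add_rpow (sub_nonneg.2 hab) hb hθ.le hθ1
    rw [sub_add_cancel] at this
    rw [of_nonneg hθ hb, of_nonneg hθ (hb.trans hab)]
    linarith
  rcases le_total a 0 with ha | ha
  · have := Real.rpow_add_le_add_rpow (sub_nonneg.2 hab) (neg_nonneg.2 ha) hθ.le hθ1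
    rw [show a - b + -a = -b by ring] at this
    rw [of_nonpos hθ hb, of_nonpos hθ ha]
    linarith
  · rw [of_nonneg hθ ha, of_nonpos hθ hb]
    have := (Real.concaveOn_rpow hθ.le hθ1).2 (Set.mem_Ici.2 ha)
      (Set.mem_Ici.2 (neg_nonneg.2 hb)) (show (0 : ℝ) ≤ 1 / 2 by norm_num)
      (show (0 : ℝ) ≤ 1 / 2 by norm_num) (by norm_num)
    simp only [smul_eq_mul] at this
    rw [show 1 / 2 * a + 1 / 2 * -b = (a - b) / 2 by ring,
      Real.div_rpow (by linarith) (by norm_num)] at this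
    rw [Real.rpow_sub two_pos, Real.rpow_one]
    calc _ = 2 * (1 / 2 * a ^ θ + 1 / 2 * (-b) ^ θ) := by ring
      _ ≤ 2 * ((a - b) ^ θ / 2 ^ θ) := by gcongr
      _ = _ := by ring

lemma sub_mul_sub_le (hθ : 0 < θ) (hθ1 : θ ≤ 1) (a b : ℝ) :
    (signedRpow θ a - signedRpow θ b) * (a - b) ≤ 2 ^ (1 - θ) * |a - b| ^ (θ + 1) := by
  wlog hab : b ≤ a generalizing a b
  · have := this b a (le_of_not_ge hab)
    rw [abs_sub_comm] at this
    linarith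
  rw [abs_of_nonneg (sub_nonneg.2 hab), Real.rpow_add_one' (sub_nonneg.2 hab) (by positivity),
    ← mul_assoc]
  exact mul_le_mul_of_nonneg_right (sub_le hθ hθ1 hab) (sub_nonneg.2 hab)

end signedRpow

section WeightedSums

variable {ι : Type*} [Fintype ι] {t : ι → ℝ}

/-- A weighted family of reals has a point annihilating the weighted sum of signed powers of the
displacements. -/
lemma exists_sum_signedRpow_sub_eq_zero {θ : ℝ} (hθ : 0 < θ) (ht : ∀ i, 0 ≤ t i) (x : ι → ℝ) :
    ∃ c : ℝ, |c| ≤ ∑ i, |x i| ∧ ∑ i, t i * signedRpow θ (x i - c) = 0 := by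
  set B := ∑ i, |x i|
  have hB : 0 ≤ B := Finset.sum_nonneg fun i _ => abs_nonneg _
  have hx : ∀ i, |x i| ≤ B := fun i =>
    Finset.single_le_sum (f := fun i => |x i|) (fun i _ => abs_nonneg _) (Finset.mem_univ i)
  have hcont : Continuous fun c => ∑ i, t i * signedRpow θ (x i - c) :=
    continuous_finsetSum _ fun i _ => continuous_const.mul
      ((signedRpow.continuous hθ).comp (continuous_const.sub continuous_id))
  have h1 : ∑ i, t i * signedRpow θ (x i - B) ≤ 0 := by
    refine Finset.sum_nonpos fun i _ => mul_nonpos_of_nonneg_of_nonpos (ht i) ?_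
    have := (abs_le.1 (hx i)).2
    rw [signedRpow.of_nonpos hθ (by linarith)]
    exact neg_nonpos.2 (Real.rpow_nonneg (by linarith) _)
  have h2 : 0 ≤ ∑ i, t i * signedRpow θ (x i - -B) := by
    refine Finset.sum_nonneg fun i _ => mul_nonneg (ht i) ?_
    have := (abs_le.1 (hx i)).1
    rw [signedRpow.of_nonneg hθ (by linarith)]
    exact Real.rpow_nonneg (by linarith) _
  obtain ⟨c, hc, hc0⟩ := intermediate_value_Icc' (neg_le_self hB) hcont.continuousOn ⟨h1, h2⟩
  exact ⟨c, abs_le.2 hc, hc0⟩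

lemma sum_sum_mul_sub_mul_sub (ht : ∑ i, t i = 1) {y u : ι → ℝ} (hy : ∑ i, t i * y i = 0) :
    ∑ i, ∑ j, t i * t j * ((y i - y j) * (u i - u j)) = 2 * ∑ i, t i * (y i * u i) := by
  have h1 : ∀ i j, t i * t j * ((y i - y j) * (u i - u j)) =
      (t i * (y i * u i)) * t j - (t i * y i) * (t j * u j) - (t i * u i) * (t j * y j)
        + t i * (t j * (y j * u j)) := fun i j => by ring
  simp_rw [h1, Finset.sum_add_distrib, Finset.sum_sub_distrib, ← Finset.sum_mul_sum, ht, hy]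
  ring

end WeightedSums

section CosIntegral

open MeasureTheory Set

variable {q : ℝ}

lemma integrableOn_one_sub_cos_mul_rpow (hq0 : 0 < q) (hq2 : q < 2) (x : ℝ) :
    IntegrableOn (fun u : ℝ => (1 - Real.cos (x * u)) * u ^ (-1 - q)) (Ioi 0) := by
  have hmeas : Measurable fun u : ℝ => (1 - Real.cos (x * u)) * u ^ (-1 - q) := by fun_prop
  rw [← Ioc_union_Ioi_eq_Ioi zero_le_one]
  refine IntegrableOn.union ?_ ?_
  · have h : IntegrableOn (fun u : ℝ => x ^ 2 / 2 * u ^ (1 - q)) (Ioc 0 1) :=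
      ((intervalIntegrable_iff_integrableOn_Ioc_of_le zero_le_one).1
        (intervalIntegral.intervalIntegrable_rpow' (by linarith))).const_mul _
    refine Integrable.mono' h hmeas.aestronglyMeasurable ?_
    filter_upwards [ae_restrict_mem measurableSet_Ioc] with u hu
    have hu0 : 0 ≤ u ^ (-1 - q) := Real.rpow_nonneg hu.1.le _
    rw [Real.norm_of_nonneg (mul_nonneg (sub_nonneg.2 (Real.cos_le_one _)) hu0)]
    calc (1 - Real.cos (x * u)) * u ^ (-1 - q) ≤ (x * u) ^ 2 / 2 * u ^ (-1 - q) := by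
          gcongr
          linarith [Real.one_sub_sq_div_two_le_cos (x := x * u)]
      _ = x ^ 2 / 2 * (u ^ (2 : ℝ) * u ^ (-1 - q)) := by
          rw [Real.rpow_two]
          ring
      _ = x ^ 2 / 2 * u ^ (1 - q) := by
          rw [← Real.rpow_add hu.1]
          ring_nf
  · have h : IntegrableOn (fun u : ℝ => 2 * u ^ (-1 - q)) (Ioi 1) :=
      (integrableOn_Ioi_rpow_of_lt (by linarith) one_pos).const_mul _
    refine Integrable.mono' h hmeas.aestronglyMeasurable ?_
    filter_upwards [ae_restrict_mem measurableSet_Ioi] with u hu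
    have hu0 : 0 ≤ u ^ (-1 - q) := Real.rpow_nonneg (zero_le_one.trans (le_of_lt hu)) _
    rw [Real.norm_of_nonneg (mul_nonneg (sub_nonneg.2 (Real.cos_le_one _)) hu0)]
    gcongr
    linarith [Real.neg_one_le_cos (x * u)]

lemma integral_one_sub_cos_mul_rpow (hq0 : 0 < q) (x : ℝ) :
    ∫ u in Ioi (0 : ℝ), (1 - Real.cos (x * u)) * u ^ (-1 - q) =
      |x| ^ q * ∫ u in Ioi (0 : ℝ), (1 - Real.cos u) * u ^ (-1 - q) := by
  wlog hx : 0 < x generalizing x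
  · rcases (not_lt.1 hx).eq_or_lt with rfl | hx
    · simp [Real.zero_rpow hq0.ne']
    · simpa using this (-x) (neg_pos.2 hx)
  have h := integral_comp_mul_left_Ioi (fun v : ℝ => (1 - Real.cos v) * v ^ (-1 - q)) 0 hx
  have h' : ∫ u in Ioi (0 : ℝ), (1 - Real.cos (x * u)) * (x * u) ^ (-1 - q) =
      x ^ (-1 - q) * ∫ u in Ioi (0 : ℝ), (1 - Real.cos (x * u)) * u ^ (-1 - q) := by
    rw [← integral_const_mul]
    refine setIntegral_congr_fun measurableSet_Ioi fun u hu => ?_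
    change _ = x ^ (-1 - q) * _
    rw [Real.mul_rpow hx.le (le_of_lt hu)]
    ring
  rw [h', mul_zero, smul_eq_mul] at h
  rw [abs_of_pos hx]
  have h2 : x ^ (1 + q) * x ^ (-1 - q) = 1 := by
    rw [← Real.rpow_add hx]
    simp
  have h3 : x ^ (1 + q) * x⁻¹ = x ^ q := by
    rw [← Real.rpow_neg_one, ← Real.rpow_add hx]
    ring_nf
  rw [← h3, mul_assoc, ← h, ← mul_assoc, h2, one_mul]

lemma integral_one_sub_cos_mul_rpow_pos (hq0 : 0 < q) (hq2 : q < 2) :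
    0 < ∫ u in Ioi (0 : ℝ), (1 - Real.cos u) * u ^ (-1 - q) := by
  have hint := integrableOn_one_sub_cos_mul_rpow hq0 hq2 1
  simp only [one_mul] at hint
  rw [setIntegral_pos_iff_support_of_nonneg_ae _ hint]
  · refine lt_of_lt_of_le ?_ (measure_mono (s := Ioo (0 : ℝ) 1) fun u hu => ⟨?_, hu.1⟩)
    · simp
    · have hcos : Real.cos u < Real.cos 0 := Real.cos_lt_cos_of_nonneg_of_le_pi le_rfl
        (by linarith [hu.2, Real.pi_gt_three]) hu.1
      rw [Real.cos_zero] at hcos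
      exact (mul_pos (sub_pos.2 hcos) (Real.rpow_pos_of_pos hu.1 _)).ne'
  · filter_upwards [ae_restrict_mem measurableSet_Ioi] with u hu
    exact mul_nonneg (sub_nonneg.2 (Real.cos_le_one _)) (Real.rpow_nonneg (le_of_lt hu) _)

variable {ι : Type*} [Fintype ι] {t : ι → ℝ}

lemma sum_sum_one_sub_cos_sub_le (ht : ∑ i, t i = 1) (y : ι → ℝ) :
    ∑ i, ∑ j, t i * t j * (1 - Real.cos (y i - y j)) ≤ 2 * ∑ i, t i * (1 - Real.cos (y i)) := by
  have h1 : ∀ i j, t i * t j * (1 - Real.cos (y i - y j)) = t i * t j -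
      (t i * Real.cos (y i)) * (t j * Real.cos (y j)) -
      (t i * Real.sin (y i)) * (t j * Real.sin (y j)) := fun i j => by
    rw [Real.cos_sub]
    ring
  simp_rw [h1, mul_sub, mul_one, Finset.sum_sub_distrib, ← Finset.sum_mul_sum, ht]
  nlinarith [sq_nonneg (1 - ∑ i, t i * Real.cos (y i)), sq_nonneg (∑ i, t i * Real.sin (y i))]

/-- The kernel `|x - y| ^ q` is conditionally negative definite for `0 < q < 2`; here this is
applied to a probability measure minus the unit mass at the origin. -/
lemma sum_sum_abs_sub_rpow_le (hq0 : 0 < q) (hq2 : q < 2) (ht : ∑ i, t i = 1) (y : ι → ℝ) :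
    ∑ i, ∑ j, t i * t j * |y i - y j| ^ q ≤ 2 * ∑ i, t i * |y i| ^ q := by
  refine le_of_mul_le_mul_right ?_ (integral_one_sub_cos_mul_rpow_pos hq0 hq2)
  have hint := integrableOn_one_sub_cos_mul_rpow hq0 hq2
  have hl : (∑ i, ∑ j, t i * t j * |y i - y j| ^ q) *
      ∫ u in Ioi (0 : ℝ), (1 - Real.cos u) * u ^ (-1 - q) =
      ∫ u in Ioi (0 : ℝ), ∑ i, ∑ j,
        t i * t j * ((1 - Real.cos ((y i - y j) * u)) * u ^ (-1 - q)) := by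
    rw [integral_finsetSum _ fun i _ => integrable_finsetSum _ fun j _ => (hint _).const_mul _,
      Finset.sum_mul]
    refine Finset.sum_congr rfl fun i _ => ?_
    rw [integral_finsetSum _ fun j _ => (hint _).const_mul _, Finset.sum_mul]
    refine Finset.sum_congr rfl fun j _ => ?_
    rw [integral_const_mul, integral_one_sub_cos_mul_rpow hq0, mul_assoc]
  have hr : (2 * ∑ i, t i * |y i| ^ q) *
      ∫ u in Ioi (0 : ℝ), (1 - Real.cos u) * u ^ (-1 - q) =
      ∫ u in Ioi (0 : ℝ), 2 * ∑ i, t i * ((1 - Real.cos (y i * u)) * u ^ (-1 - q)) := by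
    rw [integral_const_mul, integral_finsetSum _ fun i _ => (hint _).const_mul _, mul_assoc,
      Finset.sum_mul]
    congr 1
    refine Finset.sum_congr rfl fun i _ => ?_
    rw [integral_const_mul, integral_one_sub_cos_mul_rpow hq0, mul_assoc]
  rw [hl, hr]
  refine setIntegral_mono_on
    (integrable_finsetSum _ fun i _ => integrable_finsetSum _ fun j _ => (hint _).const_mul _)
    ((integrable_finsetSum _ fun i _ => (hint _).const_mul _).const_mul _)
    measurableSet_Ioi fun u hu => ?_
  have h := mul_le_mul_of_nonneg_right (sum_sum_one_sub_cos_sub_le ht fun i => y i * u)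
    (Real.rpow_nonneg (le_of_lt hu) (-1 - q))
  simpa only [Finset.sum_mul, Finset.mul_sum, mul_assoc, sub_mul (y _) (y _) u] using h

end CosIntegral

/-- The `p`-th power of the Jung constant of `ℓ^p`. -/
noncomputable def jungRpow (p : ℝ) : ℝ := if p ≤ 2 then 2 ^ (1 - p) else 1 / 2

lemma jungRpow_pos (p : ℝ) : 0 < jungRpow p := by
  unfold jungRpow
  split_ifs <;> positivity

/-- The best constant approximation of a weighted family of reals in the mean of order `p`,
estimated by its pairwise distances. -/
lemma exists_sum_abs_sub_rpow_le {ι : Type*} [Fintype ι] {t : ι → ℝ} {p : ℝ} (hp : 1 < p)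
    (ht : t ∈ stdSimplex ℝ ι) (x : ι → ℝ) :
    ∃ c : ℝ, |c| ≤ ∑ i, |x i| ∧
      ∑ i, t i * |x i - c| ^ p ≤ jungRpow p * ∑ i, ∑ j, t i * t j * |x i - x j| ^ p := by
  have hθ : 0 < p - 1 := sub_pos.2 hp
  obtain ⟨c, hcB, hc⟩ := exists_sum_signedRpow_sub_eq_zero hθ ht.1 x
  refine ⟨c, hcB, ?_⟩
  have key := sum_sum_mul_sub_mul_sub ht.2 (u := fun i => x i - c) hc
  simp only [signedRpow.mul_self hθ, sub_add_cancel, sub_sub_sub_cancel_right] at key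
  have hw : ∀ i j, 0 ≤ t i * t j := fun i j => mul_nonneg (ht.1 i) (ht.1 j)
  unfold jungRpow
  split_ifs with hp2
  · have h : ∑ i, ∑ j, t i * t j * ((signedRpow (p - 1) (x i - c) -
        signedRpow (p - 1) (x j - c)) * (x i - x j)) ≤
        2 ^ (2 - p) * ∑ i, ∑ j, t i * t j * |x i - x j| ^ p := by
      simp_rw [Finset.mul_sum]
      refine Finset.sum_le_sum fun i _ => Finset.sum_le_sum fun j _ => ?_
      have := signedRpow.sub_mul_sub_le hθ (by linarith) (x i - c) (x j - c)
      rw [sub_sub_sub_cancel_right, sub_add_cancel, show 1 - (p - 1) = 2 - p by ring] at this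
      exact (mul_le_mul_of_nonneg_left this (hw i j)).trans_eq (mul_left_comm _ _ _)
    rw [key, show 2 - p = (1 - p) + 1 by ring, Real.rpow_add two_pos, Real.rpow_one] at h
    linarith
  · have hpq := Real.HolderConjugate.conjExponent hp
    set q := Real.conjExponent p with hq
    have hq2 : q < 2 := by
      rw [hq, Real.conjExponent, div_lt_iff₀ hθ]
      linarith
    have hy : ∀ s, |signedRpow (p - 1) s| ^ q = |s| ^ p := fun s => by
      rw [signedRpow.abs_eq hθ, ← Real.rpow_mul (abs_nonneg _), hpq.sub_one_mul_conj]
    have hneg := sum_sum_abs_sub_rpow_le hpq.symm.pos hq2 ht.2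
      fun i => signedRpow (p - 1) (x i - c)
    simp only [hy] at hneg
    have h : ∑ i, ∑ j, t i * t j * ((signedRpow (p - 1) (x i - c) -
        signedRpow (p - 1) (x j - c)) * (x i - x j)) ≤
        (∑ i, ∑ j, t i * t j * |signedRpow (p - 1) (x i - c) -
          signedRpow (p - 1) (x j - c)| ^ q) / q +
        (∑ i, ∑ j, t i * t j * |x i - x j| ^ p) / p := by
      simp_rw [Finset.sum_div, ← Finset.sum_add_distrib]
      refine Finset.sum_le_sum fun i _ => Finset.sum_le_sum fun j _ => ?_
      rw [mul_div_assoc, mul_div_assoc, ← mul_add]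
      exact mul_le_mul_of_nonneg_left (Real.young_inequality _ _ hpq.symm) (hw i j)
    rw [key] at h
    have hq0 := hpq.symm.inv_nonneg
    have hsum := hpq.inv_add_inv_eq_one
    have h' := mul_le_mul_of_nonneg_right hneg hq0
    rw [div_eq_mul_inv, div_eq_mul_inv] at h
    have hpi : 0 < p⁻¹ := by positivity
    have hfin : 2 * (∑ i, t i * |x i - c| ^ p) * p⁻¹ ≤
        (∑ i, ∑ j, t i * t j * |x i - x j| ^ p) * p⁻¹ := by
      have hsplit : 2 * (∑ i, t i * |x i - c| ^ p) * p⁻¹ =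
          2 * (∑ i, t i * |x i - c| ^ p) - 2 * (∑ i, t i * |x i - c| ^ p) * q⁻¹ := by
        rw [eq_sub_of_add_eq hsum]
        ring
      linarith
    linarith [le_of_mul_le_mul_right hfin hpi]

/-- A finite minimax principle: if every weighted average of convex functions takes a value below
`M`, then all the functions are simultaneously below `M` at some point. -/
lemma exists_forall_lt_of_forall_stdSimplex {ι E : Type*} [Fintype ι] [Nonempty ι]
    [AddCommGroup E] [Module ℝ E] {g : ι → E → ℝ} (hg : ∀ i, ConvexOn ℝ Set.univ (g i)) {M : ℝ}
    (h : ∀ t ∈ stdSimplex ℝ ι, ∃ y, ∑ i, t i * g i y < M) : ∃ y, ∀ i, g i y < M := by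
  classical
  let C : Set (ι → ℝ) := {v | ∃ y, ∀ i, g i y < v i}
  have hCo : IsOpen C := by
    have : C = ⋃ y, ⋂ i, {v : ι → ℝ | g i y < v i} := by
      ext v
      simp [C]
    rw [this]
    exact isOpen_iUnion fun y => isOpen_iInter_of_finite fun i =>
      isOpen_lt continuous_const (continuous_apply i)
  have hCc : Convex ℝ C := by
    rintro v ⟨y, hy⟩ w ⟨z, hz⟩ a b ha hb hab
    refine ⟨a • y + b • z, fun i => ((hg i).2 trivial trivial ha hb hab).trans_lt ?_⟩
    simp only [smul_eq_mul, Pi.add_apply, Pi.smul_apply]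
    rcases ha.eq_or_lt with rfl | ha
    · rw [zero_add] at hab
      simp [hab, hz i]
    · nlinarith [mul_lt_mul_of_pos_left (hy i) ha, mul_le_mul_of_nonneg_left (hz i).le hb]
  by_contra hM
  have hMC : (fun _ => M) ∉ C := fun ⟨y, hy⟩ => hM ⟨y, hy⟩
  obtain ⟨f, hf⟩ := geometric_hahn_banach_point_open hCc hCo hMC
  set w : ι → ℝ := fun i => f (Pi.single i 1) with hwdef
  have hfw : ∀ v, f v = ∑ i, w i * v i := fun v => by
    conv_lhs => rw [← Finset.univ_sum_single v]
    rw [map_sum]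
    refine Finset.sum_congr rfl fun i _ => ?_
    rw [hwdef, mul_comm, ← smul_eq_mul, ← map_smul, ← Pi.single_smul, smul_eq_mul, mul_one]
  have hy0 : (fun i => g i 0 + 1) ∈ C := ⟨0, fun i => lt_add_one _⟩
  have hw0 : ∀ i, 0 ≤ w i := by
    intro i
    by_contra! hi
    set D := f (fun i => g i 0 + 1) - f (fun _ => M)
    have hD : 0 < D := sub_pos.2 (hf _ hy0)
    have hmem : (fun i => g i 0 + 1) + Pi.single i (D / -w i) ∈ C := by
      refine ⟨0, fun j => ?_⟩
      have hsingle : (0 : ι → ℝ) ≤ Pi.single i (D / -w i) :=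
        Pi.single_nonneg.2 (div_nonneg hD.le (neg_nonneg.2 hi.le))
      have := hsingle j
      simp only [Pi.add_apply, Pi.zero_apply] at this ⊢
      linarith
    have := hf _ hmem
    rw [map_add, hfw (Pi.single i _)] at this
    simp only [Pi.single_apply, mul_ite, mul_zero, Finset.sum_ite_eq', Finset.mem_univ,
      if_true] at this
    have hcalc : w i * (D / -w i) = -D := by
      rw [div_neg, mul_neg, mul_div_cancel₀ _ hi.ne]
    linarith
  have hW : 0 < ∑ i, w i := by
    refine (Finset.sum_nonneg fun i _ => hw0 i).lt_of_ne' fun h0 => ?_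
    have hz : ∀ i, w i = 0 := fun i =>
      (Finset.sum_eq_zero_iff_of_nonneg fun i _ => hw0 i).1 h0 i (Finset.mem_univ i)
    have := hf _ hy0
    simp [hfw, hz] at this
  set W := ∑ i, w i with hWdef
  obtain ⟨y, hy⟩ := h (fun i => w i / W) ⟨fun i => div_nonneg (hw0 i) hW.le, by
    rw [← Finset.sum_div, div_self hW.ne']⟩
  simp_rw [div_mul_eq_mul_div] at hy
  rw [← Finset.sum_div, div_lt_iff₀ hW] at hy
  set ε := (M * W - ∑ i, w i * g i y) / W with hε
  have hεpos : 0 < ε := div_pos (sub_pos.2 hy) hW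
  have := hf (fun i => g i y + ε) ⟨y, fun i => lt_add_of_pos_right _ hεpos⟩
  rw [hfw, hfw] at this
  simp_rw [mul_add, Finset.sum_add_distrib, ← Finset.sum_mul, ← hWdef] at this
  rw [hε, mul_div_cancel₀ _ hW.ne'] at this
  linarith

section LpSequences

variable {p : ℝ}

lemma exists_sum_norm_sub_rpow_le (hp : 1 < p) {ι : Type*} [Fintype ι] {t : ι → ℝ}
    (ht : t ∈ stdSimplex ℝ ι) (x : ι → lp (fun _ : ℕ => ℝ) (ENNReal.ofReal p)) :
    ∃ y : lp (fun _ : ℕ => ℝ) (ENNReal.ofReal p), ∑ i, t i * ‖x i - y‖ ^ p ≤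
      jungRpow p * ∑ i, ∑ j, t i * t j * ‖x i - x j‖ ^ p := by
  have hp0 : 0 < p := one_pos.trans hp
  have hreal : (ENNReal.ofReal p).toReal = p := ENNReal.toReal_ofReal hp0.le
  choose c hcB hc using fun k : ℕ => exists_sum_abs_sub_rpow_le hp ht fun i => x i k
  have hmem : Memℓp c (ENNReal.ofReal p) :=
    (Memℓp.finsetSum Finset.univ fun i _ => (lp.memℓp (x i)).norm).mono
      fun k => by simpa using hcB k
  let y : lp (fun _ : ℕ => ℝ) (ENNReal.ofReal p) := ⟨c, hmem⟩
  have hs : ∀ z : lp (fun _ : ℕ => ℝ) (ENNReal.ofReal p),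
      HasSum (fun k => |z k| ^ p) (‖z‖ ^ p) := fun z => by
    simpa [hreal] using lp.hasSum_norm (by rw [hreal]; exact hp0) z
  refine ⟨y, hasSum_le hc (hasSum_sum fun i _ => ((hs (x i - y)).mul_left (t i))) ?_⟩
  exact (hasSum_sum fun i _ => hasSum_sum fun j _ =>
    ((hs (x i - x j)).mul_left (t i * t j))).mul_left _

variable [Fact (1 ≤ ENNReal.ofReal p)]

/-- A finite family of diameter at most `d` covered by boundedly many pieces of half the diameter
has radius bounded away from the Jung bound. -/
lemma exists_forall_norm_sub_rpow_lt (hp : 1 < p) {ι κ : Type*} [Fintype ι] [Nonempty ι]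
    [Fintype κ] (x : ι → lp (fun _ : ℕ => ℝ) (ENNReal.ofReal p)) (c : ι → κ) {d M : ℝ}
    (hd : ∀ i j, ‖x i - x j‖ ≤ d) (hc : ∀ i j, c i = c j → ‖x i - x j‖ ≤ d / 2)
    (hM : jungRpow p * (d ^ p * (1 - (1 - (1 / 2) ^ p) / Fintype.card κ)) < M) :
    ∃ y : lp (fun _ : ℕ => ℝ) (ENNReal.ofReal p), ∀ i, ‖x i - y‖ ^ p < M := by
  classical
  have hp0 : 0 < p := one_pos.trans hp
  have hd0 : 0 ≤ d := (norm_nonneg _).trans (hd (Classical.arbitrary ι) (Classical.arbitrary ι))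
  have hκ : (0 : ℝ) < Fintype.card κ := by
    have : Nonempty κ := ⟨c (Classical.arbitrary ι)⟩
    exact_mod_cast Fintype.card_pos
  have hhalf : 0 ≤ 1 - (1 / 2 : ℝ) ^ p :=
    sub_nonneg.2 (Real.rpow_le_one (by norm_num) (by norm_num) hp0.le)
  refine exists_forall_lt_of_forall_stdSimplex (g := fun i y => ‖x i - y‖ ^ p) (fun i => ?_)
    fun t ht => ?_
  · have h1 : ConvexOn ℝ Set.univ
        fun y : lp (fun _ : ℕ => ℝ) (ENNReal.ofReal p) => ‖x i - y‖ := by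
      simpa only [dist_eq_norm, norm_sub_rev] using convexOn_dist (x i) convex_univ
    exact ⟨convex_univ, fun a ha b hb s r hs hr hsr =>
      (Real.rpow_le_rpow (norm_nonneg _) (h1.2 ha hb hs hr hsr) hp0.le).trans
        ((convexOn_rpow hp.le).2 (norm_nonneg _) (norm_nonneg _) hs hr hsr)⟩
  obtain ⟨y, hy⟩ := exists_sum_norm_sub_rpow_le hp ht x
  refine ⟨y, hy.trans_lt (lt_of_le_of_lt ?_ hM)⟩
  refine mul_le_mul_of_nonneg_left ?_ (jungRpow_pos p).le
  have hfib : ∑ k, ∑ i with c i = k, t i = 1 :=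
    (Finset.sum_fiberwise Finset.univ c t).trans ht.2
  have hcs : 1 / (Fintype.card κ : ℝ) ≤ ∑ i, ∑ j, t i * t j * if c i = c j then 1 else 0 := by
    have h := sq_sum_le_card_mul_sum_sq (s := Finset.univ) (f := fun k => ∑ i with c i = k, t i)
    rw [hfib, Finset.card_univ, one_pow] at h
    rw [div_le_iff₀ hκ, mul_comm]
    refine h.trans_eq ?_
    congr 1
    simp_rw [sq, Finset.sum_mul_sum, Finset.sum_filter]
    rw [Finset.sum_comm]
    refine Finset.sum_congr rfl fun i _ => ?_
    simp [eq_comm]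
  have hpt : ∀ i j, ‖x i - x j‖ ^ p ≤
      d ^ p * (1 - (1 - (1 / 2) ^ p) * if c i = c j then 1 else 0) := fun i j => by
    split_ifs with hij
    · calc _ ≤ (d * (1 / 2)) ^ p := by
            gcongr
            linarith [hc i j hij]
        _ = _ := by
            rw [Real.mul_rpow hd0 (by norm_num)]
            ring
    · have := hd i j
      simp only [mul_zero, sub_zero, mul_one]
      gcongr
  calc ∑ i, ∑ j, t i * t j * ‖x i - x j‖ ^ p
      ≤ ∑ i, ∑ j, t i * t j * (d ^ p * (1 - (1 - (1 / 2) ^ p) * if c i = c j then 1 else 0)) :=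
        Finset.sum_le_sum fun i _ => Finset.sum_le_sum fun j _ =>
          mul_le_mul_of_nonneg_left (hpt i j) (mul_nonneg (ht.1 i) (ht.1 j))
    _ = d ^ p * ((∑ i, t i) * (∑ j, t j) -
          (1 - (1 / 2) ^ p) * ∑ i, ∑ j, t i * t j * if c i = c j then 1 else 0) := by
        rw [Finset.sum_mul_sum]
        simp_rw [Finset.mul_sum, ← Finset.sum_sub_distrib, Finset.mul_sum]
        exact Finset.sum_congr rfl fun i _ => Finset.sum_congr rfl fun j _ => by ring
    _ ≤ _ := by
        rw [ht.2, one_mul, div_eq_mul_one_div (1 - (1 / 2 : ℝ) ^ p)]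
        gcongr

lemma chebRadius_le {A : Set (lp (fun _ : ℕ => ℝ) (ENNReal.ofReal p))}
    (y : lp (fun _ : ℕ => ℝ) (ENNReal.ofReal p)) {r : ℝ} (hr : 0 ≤ r)
    (h : ∀ x ∈ A, ‖x - y‖ ≤ r) : chebRadius A ≤ r :=
  (ciInf_le ⟨0, by rintro _ ⟨z, rfl⟩; exact Real.iSup_nonneg fun x => norm_nonneg _⟩ y).trans
    (Real.iSup_le (fun x => h x x.2) hr)

/-- A totally bounded set of positive diameter satisfies the Jung inequality strictly. -/
lemma chebRadius_rpow_lt (hp : 1 < p) {A : Set (lp (fun _ : ℕ => ℝ) (ENNReal.ofReal p))}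
    (hA : TotallyBounded A) (hne : A.Nonempty) (hd : 0 < Metric.diam A) (hR : 0 ≤ chebRadius A) :
    chebRadius A ^ p < jungRpow p * Metric.diam A ^ p := by
  have hp0 : 0 < p := one_pos.trans hp
  have hbdd := hA.isBounded
  set d := Metric.diam A
  set R := chebRadius A
  obtain ⟨T, hTfin, hT⟩ := Metric.totallyBounded_iff.1 hA (d / 4) (by linarith)
  have := hTfin.fintype
  have hcover : ∀ x : A, ∃ y : T, dist (x : lp (fun _ : ℕ => ℝ) (ENNReal.ofReal p)) y < d / 4 :=
    fun x => by
      obtain ⟨y, hy, hxy⟩ := Set.mem_iUnion₂.1 (hT x.2)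
      exact ⟨⟨y, hy⟩, hxy⟩
  choose c hc using hcover
  have hcard : (0 : ℝ) < Fintype.card T := by
    have : Nonempty T := ⟨c ⟨_, hne.some_mem⟩⟩
    exact_mod_cast Fintype.card_pos
  have hhalf : 0 < 1 - (1 / 2 : ℝ) ^ p :=
    sub_pos.2 (Real.rpow_lt_one (by norm_num) (by norm_num) hp0)
  by_contra! hJR
  have hlt : jungRpow p * (d ^ p * (1 - (1 - (1 / 2) ^ p) / Fintype.card T)) < R ^ p := by
    refine lt_of_lt_of_le (mul_lt_mul_of_pos_left ?_ (jungRpow_pos p)) hJR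
    exact mul_lt_of_lt_one_right (Real.rpow_pos_of_pos hd p) (sub_lt_self _ (div_pos hhalf hcard))
  obtain ⟨M, hLM, hMR⟩ := exists_between (max_lt hlt
    ((mul_pos (jungRpow_pos p) (Real.rpow_pos_of_pos hd p)).trans_le hJR))
  have hM0 : 0 ≤ M := (le_max_right _ _).trans hLM.le
  have hsR : M ^ p⁻¹ < R := by
    rw [← Real.rpow_rpow_inv hR hp0.ne']
    exact Real.rpow_lt_rpow hM0 hMR (inv_pos.2 hp0)
  obtain ⟨F, hFA, hFfin, hF⟩ :=
    Metric.finite_approx_of_totallyBounded hA ((R - M ^ p⁻¹) / 2) (by linarith)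
  have := hFfin.fintype
  have hFne : Nonempty F := by
    obtain ⟨y, hy, -⟩ := Set.mem_iUnion₂.1 (hF hne.some_mem)
    exact ⟨⟨y, hy⟩⟩
  obtain ⟨y, hy⟩ := exists_forall_norm_sub_rpow_lt hp (fun i : F => (i : lp _ _))
    (fun i => c ⟨i, hFA i.2⟩) (d := d) (M := M)
    (fun i j => by
      rw [← dist_eq_norm]
      exact Metric.dist_le_diam_of_mem hbdd (hFA i.2) (hFA j.2))
    (fun i j hij => by
      rw [← dist_eq_norm]
      have h1 := hc ⟨i, hFA i.2⟩
      have h2 := hc ⟨j, hFA j.2⟩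
      rw [← hij, dist_comm] at h2
      linarith [dist_triangle i.1 (c ⟨i, hFA i.2⟩).1 j.1])
    ((le_max_left _ _).trans_lt hLM)
  have hs0 : 0 ≤ M ^ p⁻¹ := Real.rpow_nonneg hM0 _
  have hRle : R ≤ (R - M ^ p⁻¹) / 2 + M ^ p⁻¹ := by
    refine chebRadius_le y (by linarith) fun x hx => ?_
    obtain ⟨z, hz, hxz⟩ := Set.mem_iUnion₂.1 (hF hx)
    have hzy : ‖z - y‖ ≤ M ^ p⁻¹ := by
      rw [← Real.rpow_rpow_inv (norm_nonneg (z - y)) hp0.ne']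
      exact Real.rpow_le_rpow (by positivity) (hy ⟨z, hz⟩).le (inv_pos.2 hp0).le
    rw [Metric.mem_ball, dist_eq_norm] at hxz
    calc ‖x - y‖ = ‖(x - z) + (z - y)‖ := by rw [sub_add_sub_cancel]
      _ ≤ ‖x - z‖ + ‖z - y‖ := norm_add_le _ _
      _ ≤ _ := add_le_add hxz.le hzy
  linarith

end LpSequences

theorem extremal_not_relatively_compact (p : ℝ) (hp : 1 < p)
    [Fact (1 ≤ ENNReal.ofReal p)]
    (A : Set (lp (fun _ : ℕ => ℝ) (ENNReal.ofReal p)))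
    (hbdd : Bornology.IsBounded A)
    (htwo : ∃ a ∈ A, ∃ b ∈ A, a ≠ b)
    (hext : (p ≤ 2 → chebRadius A = 2 ^ (-(1 / (p / (p - 1)))) * Metric.diam A) ∧
            (2 < p → chebRadius A = 2 ^ (-(1 / p)) * Metric.diam A)) :
    ¬ IsCompact (closure A) := by
  intro hK
  obtain ⟨a, ha, b, hb, hab⟩ := htwo
  have hp0 : 0 < p := one_pos.trans hp
  have hd : 0 < Metric.diam A :=
    (dist_pos.2 hab).trans_le (Metric.dist_le_diam_of_mem hbdd ha hb)
  have hjung : 0 ≤ chebRadius A ∧ chebRadius A ^ p = jungRpow p * Metric.diam A ^ p := by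
    rcases le_or_gt p 2 with h | h
    · rw [hext.1 h, jungRpow, if_pos h, Real.mul_rpow (by positivity) hd.le,
        ← Real.rpow_mul zero_le_two, one_div_div]
      refine ⟨by positivity, ?_⟩
      congr 2
      field_simp
      ring
    · rw [hext.2 h, jungRpow, if_neg h.not_ge, Real.mul_rpow (by positivity) hd.le,
        ← Real.rpow_mul zero_le_two, neg_mul, one_div_mul_cancel hp0.ne', Real.rpow_neg_one]
      exact ⟨by positivity, by norm_num⟩
  exact (chebRadius_rpow_lt hp (hK.totallyBounded.subset subset_closure) ⟨a, ha⟩ hd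
    hjung.1).ne hjung.2
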